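/- arXiv:math/0005100 — 4 statements merged into one kernel-verified Lean document; each statement's English description precedes it below -/
import Mathlib

section
/- Let (ℬ,𝒞) be a semi-orthogonal pair in a triangulated category 𝒜, let A be an object of 𝒜, and let B → A → C → B⟦1⟧ and B′ → A → C′ → B′⟦1⟧ be two distinguished triangles with B, B′ objects of ℬ and C, C′ objects of 𝒞. Then there exists a unique isomorphism of triangles between them whose middle component is the identity of A. -/
open CategoryTheory Limits Pretriangulated

universe v u

variable {𝒜 : Type u} [Category.{v} 𝒜] [HasZeroObject 𝒜] [Preadditive 𝒜]
  [HasShift 𝒜 ℤ] [∀ n : ℤ, (shiftFunctor 𝒜 n).Additive] [Pretriangulated 𝒜]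

/-- A predicate on the objects of a pretriangulated category defining a strict
(= closed under isomorphisms) full triangulated subcategory: it contains a zero object
and is closed under isomorphisms, shifts and cones. -/
def IsStrictFullTriangulatedSub (P : 𝒜 → Prop) : Prop :=
  (∀ ⦃X Y : 𝒜⦄, (X ≅ Y) → P X → P Y) ∧
  (∃ Z : 𝒜, IsZero Z ∧ P Z) ∧
  (∀ (X : 𝒜) (n : ℤ), P X → P (X⟦n⟧)) ∧
  (∀ (T : Triangle 𝒜), (T ∈ distTriang 𝒜) → P T.obj₁ → P T.obj₂ → P T.obj₃)

/-- A semi-orthogonal pair of strict full triangulated subcategories: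
`Hom(B, C) = 0` whenever `B ∈ ℬ` and `C ∈ 𝒞`. -/
def IsSemiOrthogonalPair (B C : 𝒜 → Prop) : Prop :=
  IsStrictFullTriangulatedSub B ∧ IsStrictFullTriangulatedSub C ∧
    ∀ ⦃X Y : 𝒜⦄, B X → C Y → ∀ f : X ⟶ Y, f = 0

/-- A morphism of distinguished triangles `T ⟶ T'` is determined by its middle component if there
are no nonzero morphisms `T.obj₁ ⟶ T'.obj₃⟦-1⟧` and `T.obj₁⟦1⟧ ⟶ T'.obj₃`. -/
theorem triangleMorphism_eq_of_hom₂_eq {T T' : Triangle 𝒜} (hT : T ∈ distTriang 𝒜)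
    (hT' : T' ∈ distTriang 𝒜) (h₁ : ∀ f : T.obj₁ ⟶ T'.obj₃⟦(-1 : ℤ)⟧, f = 0)
    (h₃ : ∀ f : T.obj₁⟦(1 : ℤ)⟧ ⟶ T'.obj₃, f = 0) {φ ψ : T ⟶ T'} (h : φ.hom₂ = ψ.hom₂) :
    φ = ψ := by
  ext
  · obtain ⟨a, ha⟩ := Triangle.coyoneda_exact₂ _ (inv_rot_of_distTriang _ hT')
      (φ.hom₁ - ψ.hom₁ : T.obj₁ ⟶ T'.obj₁) (by
        change (φ.hom₁ - ψ.hom₁) ≫ T'.mor₁ = 0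
        rw [Preadditive.sub_comp, ← φ.comm₁, ← ψ.comm₁, h, sub_self])
    rw [h₁ a] at ha
    exact sub_eq_zero.1 (ha.trans zero_comp)
  · exact h
  · obtain ⟨c, hc⟩ := T.yoneda_exact₃ hT (φ.hom₃ - ψ.hom₃) (by
      rw [Preadditive.comp_sub, φ.comm₂, ψ.comm₂, h, sub_self])
    rw [h₃ c, comp_zero] at hc
    exact sub_eq_zero.1 hc

/-- A morphism between the middle objects of two distinguished triangles `T` and `T'` extends to a
morphism of triangles if there are no nonzero morphisms `T.obj₁ ⟶ T'.obj₃`. -/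
theorem exists_triangleMorphism_hom₂_eq {T T' : Triangle 𝒜} (hT : T ∈ distTriang 𝒜)
    (hT' : T' ∈ distTriang 𝒜) (h : ∀ f : T.obj₁ ⟶ T'.obj₃, f = 0) (b : T.obj₂ ⟶ T'.obj₂) :
    ∃ φ : T ⟶ T', φ.hom₂ = b := by
  obtain ⟨a, ha⟩ := T'.coyoneda_exact₂ hT' (T.mor₁ ≫ b) (h _)
  exact ⟨completeDistinguishedTriangleMorphism T T' hT hT' a b ha, rfl⟩

/-- Given a semi-orthogonal pair `(ℬ, 𝒞)` in `𝒜`, an object `A`, and two distinguished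
triangles `B → A → C → B⟦1⟧` and `B′ → A → C′ → B′⟦1⟧` with `B, B′ ∈ ℬ` and `C, C′ ∈ 𝒞`,
there exists a unique isomorphism of triangles between them whose middle component is
the identity of `A`. -/
theorem semiOrthogonalPair_triangle_unique_iso (B C : 𝒜 → Prop)
    (hpair : IsSemiOrthogonalPair B C) (A : 𝒜)
    (B₁ C₁ : 𝒜) (f₁ : B₁ ⟶ A) (g₁ : A ⟶ C₁) (h₁ : C₁ ⟶ B₁⟦(1 : ℤ)⟧)
    (B₂ C₂ : 𝒜) (f₂ : B₂ ⟶ A) (g₂ : A ⟶ C₂) (h₂ : C₂ ⟶ B₂⟦(1 : ℤ)⟧)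
    (mem₁ : Triangle.mk f₁ g₁ h₁ ∈ distTriang 𝒜)
    (mem₂ : Triangle.mk f₂ g₂ h₂ ∈ distTriang 𝒜)
    (hB₁ : B B₁) (hC₁ : C C₁) (hB₂ : B B₂) (hC₂ : C C₂) :
    ∃! e : Triangle.mk f₁ g₁ h₁ ≅ Triangle.mk f₂ g₂ h₂, e.hom.hom₂ = 𝟙 A := by
  obtain ⟨⟨-, -, shiftB, -⟩, ⟨-, -, shiftC, -⟩, hzero⟩ := hpair
  have eq_of_hom₂ {X₁ X₂ X₃ Y₁ Y₂ Y₃ : 𝒜} {f : X₁ ⟶ X₂} {g : X₂ ⟶ X₃} {h : X₃ ⟶ X₁⟦(1 : ℤ)⟧}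
      {f' : Y₁ ⟶ Y₂} {g' : Y₂ ⟶ Y₃} {h' : Y₃ ⟶ Y₁⟦(1 : ℤ)⟧}
      (hT : Triangle.mk f g h ∈ distTriang 𝒜) (hT' : Triangle.mk f' g' h' ∈ distTriang 𝒜)
      (hX : B X₁) (hY : C Y₃) {φ ψ : Triangle.mk f g h ⟶ Triangle.mk f' g' h'}
      (e : φ.hom₂ = ψ.hom₂) : φ = ψ :=
    triangleMorphism_eq_of_hom₂_eq hT hT' (hzero hX (shiftC _ _ hY)) (hzero (shiftB _ _ hX) hY) e
  obtain ⟨φ, hφ⟩ := exists_triangleMorphism_hom₂_eq mem₁ mem₂ (hzero hB₁ hC₂) (𝟙 A)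
  obtain ⟨ψ, hψ⟩ := exists_triangleMorphism_hom₂_eq mem₂ mem₁ (hzero hB₂ hC₁) (𝟙 A)
  refine ⟨⟨φ, ψ, eq_of_hom₂ mem₁ mem₁ hB₁ hC₁ ?_, eq_of_hom₂ mem₂ mem₂ hB₂ hC₂ ?_⟩, hφ,
    fun e he => Iso.ext (eq_of_hom₂ mem₁ mem₂ hB₁ hC₂ (he.trans hφ.symm))⟩
  · rw [comp_hom₂, hφ, hψ]
    exact Category.comp_id _
  · rw [comp_hom₂, hφ, hψ]
    exact Category.comp_id _
end

section
/- Let T be an exceptional object of 𝒜. Then every object A of 𝒜 fits into a distinguished triangle B → A → C → B⟦1⟧ in which B is isomorphic to a finite direct sum of shifts of T (i.e. to an object of the form ⊕_j T⟦j⟧^{a_j}) and C satisfies Hom_𝒜(T, C⟦p⟧) = 0 for all integers p. -/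
open CategoryTheory Limits Pretriangulated

universe v u

variable {𝒜 : Type u} [Category.{v} 𝒜] [HasZeroObject 𝒜] [Preadditive 𝒜]
  [HasShift 𝒜 ℤ] [∀ n : ℤ, (shiftFunctor 𝒜 n).Additive] [Pretriangulated 𝒜]
  [HasFiniteBiproducts 𝒜]

variable (k : Type*) [Field k] [Linear k 𝒜]

/-- An object `T` of `𝒜` is exceptional if `Hom(T, T⟦i⟧) = 0` for all `i ≠ 0` and
`End(T)` is a division algebra (every nonzero endomorphism is invertible, and `𝟙 T ≠ 0`). -/
def IsExceptional (T : 𝒜) : Prop :=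
  (∀ i : ℤ, i ≠ 0 → ∀ f : T ⟶ T⟦i⟧, f = 0) ∧
  (𝟙 T : T ⟶ T) ≠ 0 ∧
  (∀ f : T ⟶ T, f ≠ 0 → ∃ g : T ⟶ T, f ≫ g = 𝟙 T ∧ g ≫ f = 𝟙 T)

/-- If every nonzero endomorphism of `X` is invertible, then `X ⟶ Y` has a finite basis over the
division ring of endomorphisms of `X`, acting by precomposition. -/
theorem exists_finite_basis_precomp {C : Type*} [Category C] [Preadditive C]
    (k : Type*) [Field k] [Linear k C] (X Y : C) [FiniteDimensional k (X ⟶ Y)]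
    (hne : 𝟙 X ≠ 0)
    (hdiv : ∀ f : X ⟶ X, f ≠ 0 → ∃ g : X ⟶ X, f ≫ g = 𝟙 X ∧ g ≫ f = 𝟙 X) :
    ∃ (n : ℕ) (e : Fin n → (X ⟶ Y)),
      (∀ φ : X ⟶ Y, ∃ a : Fin n → (X ⟶ X), ∑ i, a i ≫ e i = φ) ∧
      (∀ a : Fin n → (X ⟶ X), ∑ i, a i ≫ e i = 0 → ∀ i, a i = 0) := by
  classical
  have : Nontrivial (End X)ᵐᵒᵖ :=
    ⟨⟨1, 0, fun h => hne (congrArg MulOpposite.unop h)⟩⟩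
  let _ : DivisionRing (End X)ᵐᵒᵖ := DivisionRing.ofIsUnitOrEqZero fun a => by
    by_cases ha : a = 0
    · exact Or.inr ha
    · obtain ⟨g, h₁, h₂⟩ := hdiv a.unop (fun h => ha (MulOpposite.unop_injective h))
      exact Or.inl ⟨⟨a, MulOpposite.op g, MulOpposite.unop_injective h₁,
        MulOpposite.unop_injective h₂⟩, rfl⟩
  have : IsScalarTower k (End X)ᵐᵒᵖ (X ⟶ Y) := ⟨fun r a f => Linear.smul_comp _ _ _ r a.unop f⟩
  have : Module.Finite (End X)ᵐᵒᵖ (X ⟶ Y) := Module.Finite.of_restrictScalars_finite k _ _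
  let b := Module.finBasis (End X)ᵐᵒᵖ (X ⟶ Y)
  refine ⟨_, b, fun φ => ⟨fun i => (b.repr φ i).unop, b.sum_repr φ⟩, fun a ha i => ?_⟩
  exact congrArg MulOpposite.unop
    (Fintype.linearIndependent_iff.mp b.linearIndependent (fun i => MulOpposite.op (a i)) ha i)

namespace CategoryTheory

variable {C : Type*} [Category C] [Preadditive C] [HasShift C ℤ]
  [∀ n : ℤ, (shiftFunctor C n).Additive]

/-- Vanishing of `T ⟶ Y⟦p⟧` follows from vanishing of `T⟦-p⟧ ⟶ Y`. -/
theorem eq_zero_of_forall_shift_neg_hom_eq_zero {T Y : C} {p : ℤ}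
    (h : ∀ ψ : T⟦-p⟧ ⟶ Y, ψ = 0) (φ : T ⟶ Y⟦p⟧) : φ = 0 := by
  apply (shiftFunctor C (-p)).map_injective
  rw [Functor.map_zero, ← cancel_mono (shiftShiftNeg Y p).hom, zero_comp]
  exact h _

/-- Vanishing of `T⟦q⟧ ⟶ Y` follows from vanishing of `T ⟶ Y⟦-q⟧`. -/
theorem eq_zero_of_forall_hom_shift_neg_eq_zero {T Y : C} {q : ℤ}
    (h : ∀ ψ : T ⟶ Y⟦-q⟧, ψ = 0) (φ : T⟦q⟧ ⟶ Y) : φ = 0 := by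
  apply (shiftFunctor C (-q)).map_injective
  rw [Functor.map_zero, ← cancel_epi (shiftShiftNeg T q).inv, comp_zero]
  exact h _

end CategoryTheory

namespace IsExceptional

variable {C : Type*} [Category C] [Preadditive C] [HasShift C ℤ]
  [∀ n : ℤ, (shiftFunctor C n).Additive] {T : C}

theorem shift_hom_shift_eq_zero (hT : IsExceptional T) {p q : ℤ} (hpq : p ≠ q)
    (f : T⟦p⟧ ⟶ T⟦q⟧) : f = 0 := by
  refine eq_zero_of_forall_hom_shift_neg_eq_zero (fun ψ => ?_) f
  rw [← cancel_mono ((shiftFunctorAdd C q (-p)).inv.app T), zero_comp]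
  exact hT.1 _ (by omega) _

theorem shift_id_ne_zero (hT : IsExceptional T) (q : ℤ) : 𝟙 (T⟦q⟧) ≠ 0 := fun h =>
  hT.2.1 ((shiftFunctor C q).map_injective (by simpa using h))

theorem exists_shift_inverse (hT : IsExceptional T) (q : ℤ) (f : T⟦q⟧ ⟶ T⟦q⟧) (hf : f ≠ 0) :
    ∃ g : T⟦q⟧ ⟶ T⟦q⟧, f ≫ g = 𝟙 _ ∧ g ≫ f = 𝟙 _ := by
  obtain ⟨f, rfl⟩ := (shiftFunctor C q).map_surjective f
  obtain ⟨g, h₁, h₂⟩ := hT.2.2 f (by rintro rfl; exact hf (Functor.map_zero _ _ _))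
  exact ⟨g⟦q⟧', by rw [← Functor.map_comp, h₁, CategoryTheory.Functor.map_id],
    by rw [← Functor.map_comp, h₂, CategoryTheory.Functor.map_id]⟩

/-- Every object `A` receives a map from a finite direct sum of shifts of an exceptional object
`T` which induces bijections on maps out of all shifts of `T`. -/
theorem exists_biproduct_shift_hom [HasFiniteBiproducts C] (k : Type*) [Field k] [Linear k C]
    (hfin : ∀ X Y : C, FiniteDimensional k (X ⟶ Y))
    (hbdd : ∀ X Y : C, {i : ℤ | ∃ f : X ⟶ Y⟦i⟧, f ≠ 0}.Finite)
    (hT : IsExceptional T) (A : C) :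
    ∃ (m : ℕ) (j : Fin m → ℤ) (f : (⨁ fun i => T⟦j i⟧) ⟶ A), ∀ q : ℤ,
      (∀ φ : T⟦q⟧ ⟶ A, ∃ u, u ≫ f = φ) ∧
      (∀ u : T⟦q⟧ ⟶ ⨁ fun i => T⟦j i⟧, u ≫ f = 0 → u = 0) := by
  classical
  choose n e he_span he_indep using fun q : ℤ =>
    have := hfin (T⟦q⟧) A
    exists_finite_basis_precomp k (T⟦q⟧) A (hT.shift_id_ne_zero q) (hT.exists_shift_inverse q)
  let S : Finset ℤ := (hbdd T A).toFinset.image Neg.neg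
  have hS (q : ℤ) (hq : q ∉ S) (φ : T⟦q⟧ ⟶ A) : φ = 0 := by
    refine eq_zero_of_forall_hom_shift_neg_eq_zero (fun ψ => ?_) φ
    by_contra hψ
    exact hq (Finset.mem_image.mpr ⟨-q, by simpa using ⟨ψ, hψ⟩, neg_neg q⟩)
  let ι := Σ q : S, Fin (n q)
  let d : (⨁ fun x : ι => T⟦(x.1 : ℤ)⟧) ⟶ A := biproduct.desc fun x => e x.1 x.2
  have hd (q : ℤ) (φ : T⟦q⟧ ⟶ A) : ∃ u, u ≫ d = φ := by
    by_cases hq : q ∈ S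
    · obtain ⟨a, rfl⟩ := he_span q φ
      refine ⟨∑ l, a l ≫ biproduct.ι (fun x : ι => T⟦(x.1 : ℤ)⟧) ⟨⟨q, hq⟩, l⟩, ?_⟩
      simp [d, Preadditive.sum_comp]
    · exact ⟨0, by rw [zero_comp, hS q hq φ]⟩
  have hd' (q : ℤ) (u : T⟦q⟧ ⟶ ⨁ fun x : ι => T⟦(x.1 : ℤ)⟧) (hu : u ≫ d = 0) : u = 0 := by
    apply biproduct.hom_ext
    rintro ⟨⟨p, hp⟩, l⟩
    rw [zero_comp]
    by_cases hpq : q = p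
    · subst hpq
      refine he_indep q
        (fun l => u ≫ biproduct.π (fun x : ι => T⟦(x.1 : ℤ)⟧) ⟨⟨q, hp⟩, l⟩) ?_ l
      rw [← hu, show d = _ from biproduct.desc_eq, Preadditive.comp_sum, Fintype.sum_sigma,
        Fintype.sum_eq_single (⟨q, hp⟩ : S)]
      · simp
      · intro p hpq
        refine Finset.sum_eq_zero fun l _ => ?_
        rw [← Category.assoc, hT.shift_hom_shift_eq_zero (fun h => hpq (Subtype.ext h.symm))
          (u ≫ biproduct.π (fun x : ι => T⟦(x.1 : ℤ)⟧) ⟨p, l⟩), zero_comp]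
    · exact hT.shift_hom_shift_eq_zero hpq _
  let r := (Fintype.equivFin ι).symm
  let w : (⨁ fun i => T⟦((r i).1 : ℤ)⟧) ≅ ⨁ fun x : ι => T⟦(x.1 : ℤ)⟧ :=
    biproduct.whiskerEquiv (g := fun x : ι => T⟦(x.1 : ℤ)⟧) r fun _ => Iso.refl _
  refine ⟨_, fun i => (r i).1, w.hom ≫ d, fun q => ⟨fun φ => ?_, fun u hu => ?_⟩⟩
  · obtain ⟨u, rfl⟩ := hd q φ
    exact ⟨u ≫ w.inv, by simp⟩
  · rw [← cancel_mono w.hom, zero_comp]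
    exact hd' q _ (by rwa [Category.assoc])

end IsExceptional

/-- Let `𝒜` be a `k`-linear triangulated category with finite-dimensional Hom-spaces such
that for each pair of objects only finitely many shifted Hom-spaces are nonzero, and let
`T` be an exceptional object. Then every object `A` fits into a distinguished triangle
`B → A → C → B⟦1⟧` where `B` is isomorphic to a finite direct sum of shifts of `T` and
`Hom(T, C⟦p⟧) = 0` for all integers `p`. -/
theorem exceptional_semiorthogonal_triangle
    (hfin : ∀ X Y : 𝒜, FiniteDimensional k (X ⟶ Y))
    (hbdd : ∀ X Y : 𝒜, {i : ℤ | ∃ f : X ⟶ Y⟦i⟧, f ≠ 0}.Finite)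
    (T : 𝒜) (hT : IsExceptional T) (A : 𝒜) :
    ∃ (X Y : 𝒜) (f : X ⟶ A) (g : A ⟶ Y) (h : Y ⟶ X⟦(1 : ℤ)⟧),
      (Triangle.mk f g h ∈ distTriang 𝒜) ∧
      (∃ (m : ℕ) (j : Fin m → ℤ), Nonempty (X ≅ ⨁ fun i : Fin m => T⟦j i⟧)) ∧
      (∀ (p : ℤ) (φ : T ⟶ Y⟦p⟧), φ = 0) := by
  obtain ⟨m, j, f, hf⟩ := hT.exists_biproduct_shift_hom k hfin hbdd A
  obtain ⟨Y, g, h, hdist⟩ := distinguished_cocone_triangle f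
  refine ⟨_, Y, f, g, h, hdist, ⟨m, j, ⟨Iso.refl _⟩⟩, fun p =>
    eq_zero_of_forall_shift_neg_hom_eq_zero fun ψ => ?_⟩
  have hψ : ψ ≫ h = 0 := by
    let c := (shiftFunctorAdd' 𝒜 (-p - 1) 1 (-p) (by omega)).app T
    obtain ⟨u, hu⟩ := (shiftFunctor 𝒜 (1 : ℤ)).map_surjective (c.inv ≫ ψ ≫ h)
    have hu₀ : u = 0 := by
      refine (hf _).2 u ((shiftFunctor 𝒜 (1 : ℤ)).map_injective ?_)
      have hhf : h ≫ f⟦(1 : ℤ)⟧' = 0 := comp_distTriang_mor_zero₃₁ _ hdist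
      rw [Functor.map_comp, hu, Functor.map_zero]
      simp [hhf]
    rw [← cancel_epi c.inv, ← hu, hu₀, Functor.map_zero, comp_zero]
  obtain ⟨χ, rfl⟩ := Triangle.coyoneda_exact₃ _ hdist ψ hψ
  obtain ⟨v, rfl⟩ := (hf _).1 χ
  have hfg : f ≫ g = 0 := comp_distTriang_mor_zero₁₂ _ hdist
  exact (Category.assoc v f g).trans (by rw [hfg, comp_zero])
end

section
/- Let T_1,…,T_n be an exceptional collection in 𝒜 and let ℬ be the triangulated subcategory of 𝒜 generated by T_1,…,T_n. Then Hom_𝒜(B, C) = 0 for every object B of ℬ and every object C of T^⊥, and the triangulated subcategory of 𝒜 generated by the objects of ℬ together with the objects of T^⊥ is all of 𝒜 (so (ℬ, T^⊥) is a semi-orthogonal decomposition of 𝒜). -/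
open CategoryTheory Limits Pretriangulated

universe v u

variable {𝒜 : Type u} [Category.{v} 𝒜] [HasZeroObject 𝒜] [Preadditive 𝒜]
  [HasShift 𝒜 ℤ] [∀ n : ℤ, (shiftFunctor 𝒜 n).Additive] [Pretriangulated 𝒜]

variable (k : Type*) [Field k] [Linear k 𝒜]

/-- Membership in the triangulated subcategory of `𝒜` generated by a class `S` of objects. -/
def InTriangulatedSubGeneratedBy (S : 𝒜 → Prop) (X : 𝒜) : Prop :=
  ∀ P : 𝒜 → Prop, IsStrictFullTriangulatedSub P → (∀ ⦃Y : 𝒜⦄, S Y → P Y) → P X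

/-- If all maps from `X` to shifts of `Y` vanish, so do all maps from shifts of `X` to shifts of
`Y`. -/
theorem eq_zero_of_forall_shift_eq_zero {X Y : 𝒜} (h : ∀ (p : ℤ) (f : X ⟶ Y⟦p⟧), f = 0)
    (m p : ℤ) (f : X⟦m⟧ ⟶ Y⟦p⟧) : f = 0 := by
  apply (shiftFunctor 𝒜 (-m)).map_injective
  rw [Functor.map_zero, ← cancel_epi (shiftShiftNeg X m).inv,
    ← cancel_mono ((shiftFunctorAdd 𝒜 p (-m)).inv.app Y)]
  exact (h (p + -m) _).trans (by rw [comp_zero, zero_comp])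

/-- The objects all of whose maps to shifts of `Y` vanish form a strict full triangulated
subcategory. -/
theorem isStrictFullTriangulatedSub_leftOrthogonal (Y : 𝒜) :
    IsStrictFullTriangulatedSub (fun X : 𝒜 => ∀ (p : ℤ) (f : X ⟶ Y⟦p⟧), f = 0) := by
  refine ⟨fun X X' e hX p f => ?_, ⟨_, isZero_zero 𝒜, fun p f => (isZero_zero 𝒜).eq_of_src _ _⟩,
    fun X m hX p f => eq_zero_of_forall_shift_eq_zero hX m p f, fun D hD h₁ h₂ p f => ?_⟩
  · rw [← cancel_epi e.hom, hX p (e.hom ≫ f), comp_zero]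
  · obtain ⟨g, rfl⟩ := D.yoneda_exact₃ hD f (h₂ p _)
    rw [eq_zero_of_forall_shift_eq_zero h₁ 1 p g, comp_zero]

theorem IsStrictFullTriangulatedSub.obj₂ {P : 𝒜 → Prop} (hP : IsStrictFullTriangulatedSub P)
    (D : Triangle 𝒜) (hD : D ∈ distTriang 𝒜) (h₁ : P D.obj₁) (h₃ : P D.obj₃) : P D.obj₂ :=
  hP.2.2.2 D.invRotate (inv_rot_of_distTriang _ hD) (hP.2.2.1 _ _ h₃) h₁

/-- The functor `Hom(T, -⟦q⟧)` is exact at the third object of a distinguished triangle. -/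
theorem exists_lift_shift_of_comp_eq_zero {T : 𝒜} (D : Triangle 𝒜) (hD : D ∈ distTriang 𝒜) (q : ℤ)
    (c : T ⟶ D.obj₃⟦q⟧) (hc : c ≫ D.mor₃⟦q⟧' = 0) :
    ∃ a : T ⟶ D.obj₂⟦q⟧, a ≫ D.mor₂⟦q⟧' = c := by
  have hz : c ≫ (q.negOnePow • (D.mor₃⟦q⟧' ≫ (shiftFunctorComm 𝒜 1 q).hom.app D.obj₁)) = 0 := by
    rw [Units.smul_def, Preadditive.comp_zsmul, reassoc_of% hc, zero_comp, smul_zero]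
  obtain ⟨a, ha⟩ : ∃ a : T ⟶ D.obj₂⟦q⟧, c = a ≫ (q.negOnePow • D.mor₂⟦q⟧') :=
    Triangle.coyoneda_exact₃ _ (Triangle.shift_distinguished D hD q) c hz
  refine ⟨(q.negOnePow : ℤ) • a, ?_⟩
  rw [ha, Units.smul_def, Preadditive.comp_zsmul, Preadditive.zsmul_comp]

/-- Maps from an exceptional object `T` to `C⟦q⟧` lift along `A⟦q⟧ ⟶ C⟦q⟧` for a distinguished
triangle `X ⟶ A ⟶ C ⟶ X⟦1⟧` in which `X⟦1⟧⟦q⟧` is isomorphic to `T` and `X ⟶ A` is nonzero. -/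
theorem IsExceptional.exists_lift_shift {T : 𝒜} (hT : IsExceptional T) (D : Triangle 𝒜)
    (hD : D ∈ distTriang 𝒜) (q : ℤ) (e : (D.obj₁⟦(1 : ℤ)⟧)⟦q⟧ ≅ T) (h : D.mor₁ ≠ 0)
    (c : T ⟶ D.obj₃⟦q⟧) : ∃ a : T ⟶ D.obj₂⟦q⟧, a ≫ D.mor₂⟦q⟧' = c := by
  refine exists_lift_shift_of_comp_eq_zero D hD q c ?_
  by_contra hc
  obtain ⟨v, -, hv⟩ := hT.2.2 ((c ≫ D.mor₃⟦q⟧') ≫ e.hom)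
    (fun h0 => hc (by rw [← cancel_mono e.hom, h0, zero_comp]))
  refine h ((shiftFunctor 𝒜 (1 : ℤ)).map_injective ((shiftFunctor 𝒜 q).map_injective ?_))
  have h0 : D.mor₃⟦q⟧' ≫ (D.mor₁⟦(1 : ℤ)⟧')⟦q⟧' = 0 := by
    rw [← Functor.map_comp, comp_distTriang_mor_zero₃₁ D hD, Functor.map_zero]
  have h1 : e.inv ≫ (D.mor₁⟦(1 : ℤ)⟧')⟦q⟧' = 0 := by
    rw [← Category.id_comp e.inv, ← hv]
    simp [h0]
  rw [Functor.map_zero, Functor.map_zero, ← cancel_epi e.inv, h1, comp_zero]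

/-- The isomorphism `T⟦p⟧⟦1⟧⟦q⟧ ≅ T⟦r⟧` for `p + 1 + q = r`. -/
noncomputable def shiftOneShiftIso (T : 𝒜) (p q r : ℤ) (h : p + 1 + q = r) :
    ((T⟦p⟧)⟦(1 : ℤ)⟧)⟦q⟧ ≅ T⟦r⟧ :=
  (shiftFunctor 𝒜 q).mapIso ((shiftFunctorAdd 𝒜 p 1).symm.app T) ≪≫
    (shiftFunctorAdd' 𝒜 (p + 1) q r h).symm.app T

/-- Let `Q` be a class of objects that is stable under taking the cone of a map from a shift of the
exceptional object `T`. If a triangulated subcategory `P` contains `T` and the objects of `Q` right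
orthogonal to `T`, then it contains every object of `Q` whose graded Hom-space from `T` is finite
dimensional. -/
theorem IsExceptional.mem_of_forall_orthogonal
    (hfin : ∀ X Y : 𝒜, FiniteDimensional k (X ⟶ Y)) {T : 𝒜} (hT : IsExceptional T)
    {P Q : 𝒜 → Prop} (hP : IsStrictFullTriangulatedSub P) (hPT : P T)
    (hQ : ∀ D ∈ distTriang 𝒜, ∀ p : ℤ, D.obj₁ = T⟦p⟧ → Q D.obj₂ → Q D.obj₃)
    (h : ∀ A : 𝒜, Q A → (∀ (p : ℤ) (f : T ⟶ A⟦p⟧), f = 0) → P A) (s : Finset ℤ) (N : ℕ)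
    (A : 𝒜) (hA : Q A) (hs : ∀ q ∉ s, ∀ f : T ⟶ A⟦q⟧, f = 0)
    (hN : ∑ q ∈ s, Module.finrank k (T ⟶ A⟦q⟧) ≤ N) : P A := by
  induction N using Nat.strong_induction_on generalizing A with
  | _ N ih =>
  by_cases h0 : ∀ (p : ℤ) (f : T ⟶ A⟦p⟧), f = 0
  · exact h A hA h0
  push Not at h0
  obtain ⟨p, f, hf⟩ := h0
  have hps : p ∈ s := by
    by_contra hp
    exact hf (hs p hp f)
  let e := shiftNegShift T p
  obtain ⟨f', hf'⟩ := (shiftFunctor 𝒜 p).map_surjective (e.hom ≫ f)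
  obtain ⟨C, g, d, hD⟩ := distinguished_cocone_triangle f'
  have hf'0 : f' ≠ 0 := by
    rintro rfl
    apply hf
    rw [← cancel_epi e.hom, ← hf', Functor.map_zero, comp_zero]
  have hsurj : ∀ (q : ℤ) (c : T ⟶ C⟦q⟧), ∃ a : T ⟶ A⟦q⟧, a ≫ g⟦q⟧' = c := by
    intro q c
    by_cases hq : -p + 1 + q = 0
    · exact hT.exists_lift_shift _ hD q
        (shiftOneShiftIso T (-p) q 0 hq ≪≫ (shiftFunctorZero 𝒜 ℤ).app T) hf'0 c
    · have hz : ∀ x : T ⟶ ((T⟦-p⟧)⟦(1 : ℤ)⟧)⟦q⟧, x = 0 := fun x => by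
        rw [← cancel_mono (shiftOneShiftIso T (-p) q _ rfl).hom, zero_comp]
        exact hT.1 _ hq _
      exact exists_lift_shift_of_comp_eq_zero _ hD q c (hz _)
  have hle : ∀ q : ℤ, Module.finrank k (T ⟶ C⟦q⟧) ≤
      Module.finrank k (T ⟶ A⟦q⟧) := fun q => by
    have := hfin T (A⟦q⟧)
    exact LinearMap.finrank_le_finrank_of_surjective
      (f := Linear.rightComp k T (g⟦q⟧')) (hsurj q)
  have hlt : Module.finrank k (T ⟶ C⟦p⟧) < Module.finrank k (T ⟶ A⟦p⟧) := by
    have := hfin T (A⟦p⟧)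
    have hrn := LinearMap.finrank_range_add_finrank_ker (Linear.rightComp k T (g⟦p⟧'))
    rw [LinearMap.range_eq_top (f := Linear.rightComp k T (g⟦p⟧')).2 (hsurj p), finrank_top] at hrn
    have hker : f ∈ LinearMap.ker (Linear.rightComp k T (g⟦p⟧')) := by
      have hfe : f = e.inv ≫ f'⟦p⟧' := by rw [hf', e.inv_hom_id_assoc]
      have hz : f' ≫ g = 0 := comp_distTriang_mor_zero₁₂ _ hD
      simp [hfe, ← Functor.map_comp, hz]
    have hpos : 0 < Module.finrank k (LinearMap.ker (Linear.rightComp k T (g⟦p⟧'))) :=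
      Module.finrank_pos_iff_exists_ne_zero.2 ⟨⟨f, hker⟩, fun hz => hf (congrArg Subtype.val hz)⟩
    omega
  refine hP.obj₂ _ hD (hP.2.2.1 _ _ hPT) ?_
  refine ih _ ((Finset.sum_lt_sum (fun q _ => hle q) ⟨p, hps, hlt⟩).trans_le hN) C
    (hQ _ hD (-p) rfl hA) (fun q hq c => ?_) le_rfl
  obtain ⟨a, rfl⟩ := hsurj q c
  rw [hs q hq a, zero_comp]

/-- Let `T_1, …, T_n` be an exceptional collection in `𝒜` and `ℬ` the triangulated
subcategory generated by the `T_i`. Then `Hom(B, C) = 0` for all `B ∈ ℬ` and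
`C ∈ T^⊥`, and the triangulated subcategory generated by the objects of `ℬ` together
with those of `T^⊥` is all of `𝒜`: `(ℬ, T^⊥)` is a semi-orthogonal decomposition. -/
theorem exceptionalCollection_semiorthogonal_decomposition
    (hfin : ∀ X Y : 𝒜, FiniteDimensional k (X ⟶ Y))
    (hbdd : ∀ X Y : 𝒜, {i : ℤ | ∃ f : X ⟶ Y⟦i⟧, f ≠ 0}.Finite)
    (n : ℕ) (T : Fin n → 𝒜)
    (hexc : ∀ i, IsExceptional (T i))
    (hcoll : ∀ i j : Fin n, i < j → ∀ (p : ℤ) (f : T i ⟶ (T j)⟦p⟧), f = 0) :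
    (∀ X : 𝒜, InTriangulatedSubGeneratedBy (fun Y => ∃ i, Y = T i) X →
      ∀ Y : 𝒜, (∀ (i : Fin n) (p : ℤ) (φ : T i ⟶ Y⟦p⟧), φ = 0) →
      ∀ f : X ⟶ Y, f = 0) ∧
    (∀ A : 𝒜, InTriangulatedSubGeneratedBy
      (fun Y => (∃ i, Y = T i) ∨ (∀ (i : Fin n) (p : ℤ) (φ : T i ⟶ Y⟦p⟧), φ = 0)) A) := by
  refine ⟨fun X hX Y hY f => ?_, fun A P hP hS => ?_⟩
  · have h := hX _ (isStrictFullTriangulatedSub_leftOrthogonal Y)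
      (by rintro _ ⟨i, rfl⟩; exact hY i) 0 (f ≫ (shiftFunctorZero 𝒜 ℤ).inv.app Y)
    rwa [← cancel_mono ((shiftFunctorZero 𝒜 ℤ).inv.app Y), zero_comp]
  · suffices H : ∀ m ≤ n, ∀ A : 𝒜,
        (∀ i : Fin n, (i : ℕ) < m → ∀ (p : ℤ) (f : T i ⟶ A⟦p⟧), f = 0) → P A from
      H 0 n.zero_le A (fun i hi => absurd hi (Nat.not_lt_zero _))
    intro m hm
    induction hm using Nat.decreasingInduction with
    | self => exact fun A hA => hS (Or.inr fun i => hA i i.2)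
    | of_succ m hm ih =>
      intro A hA
      refine (hexc ⟨m, hm⟩).mem_of_forall_orthogonal k hfin
        (Q := fun B => ∀ i : Fin n, (i : ℕ) < m → ∀ (p : ℤ) (f : T i ⟶ B⟦p⟧), f = 0)
        hP (hS (Or.inl ⟨_, rfl⟩)) ?_ ?_
        (hbdd (T ⟨m, hm⟩) A).toFinset _ A hA ?_ le_rfl
      · rintro D hD p hp hD₂ i hi q c
        obtain ⟨a, rfl⟩ := exists_lift_shift_of_comp_eq_zero D hD q c (by
          let e : (D.obj₁⟦(1 : ℤ)⟧)⟦q⟧ ≅ (T ⟨m, hm⟩)⟦p + 1 + q⟧ :=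
            (shiftFunctor 𝒜 q).mapIso ((shiftFunctor 𝒜 (1 : ℤ)).mapIso (eqToIso hp)) ≪≫
              shiftOneShiftIso (T ⟨m, hm⟩) p q _ rfl
          rw [← cancel_mono e.hom, zero_comp]
          exact hcoll i ⟨m, hm⟩ hi _ _)
        rw [hD₂ i hi q a, zero_comp]
      · intro B hB hB'
        refine ih B fun i hi => ?_
        rcases Nat.lt_succ_iff_lt_or_eq.1 hi with hi | rfl
        · exact hB i hi
        · exact hB'
      · intro q hq f
        by_contra hf
        exact hq ((hbdd _ _).mem_toFinset.2 ⟨f, hf⟩)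
end

section
/- Let ℬ be an abelian category and T an object of ℬ of projective dimension ≤ 1. Let X be a bounded cochain complex of objects of ℬ, regarded as an object of the derived category D(ℬ), and suppose that Hom_{D(ℬ)}(T, X⟦i⟧) = 0 for all integers i. Then every cohomology object of X is right perpendicular to T, i.e. Ext^i_ℬ(T, H^n(X)) = 0 for all n ∈ ℤ and all i ≥ 0. -/
open CategoryTheory Limits

universe w w' v u

theorem CategoryTheory.Iso.eq_zero_of_forall_eq_zero {C : Type u} [Category.{v} C] [HasZeroMorphisms C]
    {A X Y : C} (e : X ≅ Y)
    (h : ∀ f : A ⟶ X, f = 0) (f : A ⟶ Y) : f = 0 := by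
  rw [← cancel_mono e.inv, zero_comp]
  exact h _

section Pretriangulated

open Pretriangulated

variable {C : Type u} [Category.{v} C] [HasZeroObject C] [HasShift C ℤ] [Preadditive C]
  [∀ n : ℤ, (shiftFunctor C n).Additive] [Pretriangulated C]

theorem CategoryTheory.Pretriangulated.eq_zero_of_hom_shift_obj₁_obj₃
    {D : Triangle C} (hD : D ∈ distTriang C) {A : C} {i : ℤ}
    (h₁ : ∀ f : A ⟶ D.obj₁⟦i⟧, f = 0) (h₃ : ∀ f : A ⟶ D.obj₃⟦i⟧, f = 0)
    (f : A ⟶ D.obj₂⟦i⟧) : f = 0 := by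
  obtain ⟨g, rfl⟩ := Triangle.coyoneda_exact₂ _ (Triangle.shift_distinguished _ hD i) f (h₃ _)
  have hg : g = 0 := h₁ g
  rw [hg, zero_comp]
  rfl

theorem CategoryTheory.Pretriangulated.eq_zero_of_hom_shift_obj₂_obj₁
    {D : Triangle C} (hD : D ∈ distTriang C) {A : C} {i j : ℤ} (hij : i + 1 = j)
    (h₂ : ∀ f : A ⟶ D.obj₂⟦i⟧, f = 0) (h₁ : ∀ f : A ⟶ D.obj₁⟦j⟧, f = 0)
    (f : A ⟶ D.obj₃⟦i⟧) : f = 0 :=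
  eq_zero_of_hom_shift_obj₁_obj₃ (rot_of_distTriang _ hD) h₂
    (((shiftFunctorAdd' C 1 i j (by lia)).app D.obj₁).eq_zero_of_forall_eq_zero h₁) f

theorem CategoryTheory.Pretriangulated.eq_zero_of_hom_shift_obj₃_obj₂
    {D : Triangle C} (hD : D ∈ distTriang C) {A : C} {i j : ℤ} (hij : i + 1 = j)
    (h₃ : ∀ f : A ⟶ D.obj₃⟦i⟧, f = 0) (h₂ : ∀ f : A ⟶ D.obj₂⟦j⟧, f = 0)
    (f : A ⟶ D.obj₁⟦j⟧) : f = 0 :=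
  eq_zero_of_hom_shift_obj₁_obj₃ (inv_rot_of_distTriang _ hD)
    (((shiftFunctorAdd' C (-1) j i (by lia)).app D.obj₃).eq_zero_of_forall_eq_zero h₃) h₂ f

end Pretriangulated

namespace DerivedCategory

open TStructure Pretriangulated

variable {ℬ : Type u} [Category.{v} ℬ] [Abelian ℬ] [HasDerivedCategory.{w'} ℬ]

theorem isIso_homologyFunctor_map_truncGEπ (Z : DerivedCategory ℬ) (n i : ℤ) (h : n ≤ i) :
    IsIso ((homologyFunctor ℬ i).map ((t.truncGEπ n).app Z)) := by
  have hD := t.triangleLTGE_distinguished n Z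
  have : Mono ((homologyFunctor ℬ i).map ((t.triangleLTGE n).obj Z).mor₂) := by
    rw [HomologySequence.mono_homologyMap_mor₂_iff _ hD]
    exact (isZero_of_isLE _ (n - 1) i (by lia)).eq_of_src _ _
  have : Epi ((homologyFunctor ℬ i).map ((t.triangleLTGE n).obj Z).mor₂) := by
    rw [HomologySequence.epi_homologyMap_mor₂_iff _ hD i (i + 1)]
    exact (isZero_of_isLE _ (n - 1) (i + 1) (by lia)).eq_of_tgt _ _
  exact isIso_of_mono_of_epi ((homologyFunctor ℬ i).map ((t.triangleLTGE n).obj Z).mor₂)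

theorem isIso_homologyFunctor_map_truncLTι (Z : DerivedCategory ℬ) (n i : ℤ) (h : i < n) :
    IsIso ((homologyFunctor ℬ i).map ((t.truncLTι n).app Z)) := by
  have hD := t.triangleLTGE_distinguished n Z
  have : Mono ((homologyFunctor ℬ i).map ((t.triangleLTGE n).obj Z).mor₁) := by
    rw [HomologySequence.mono_homologyMap_mor₁_iff _ hD (i - 1) i]
    exact (isZero_of_isGE _ n (i - 1) (by lia)).eq_of_src _ _
  have : Epi ((homologyFunctor ℬ i).map ((t.triangleLTGE n).obj Z).mor₁) := by
    rw [HomologySequence.epi_homologyMap_mor₁_iff _ hD]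
    exact (isZero_of_isGE _ n i (by lia)).eq_of_tgt _ _
  exact isIso_of_mono_of_epi ((homologyFunctor ℬ i).map ((t.triangleLTGE n).obj Z).mor₁)

/-- The truncation of `Z` in a single degree `n` is `H^n(Z)` placed in degree `n`. -/
theorem nonempty_truncLTGE_obj_iso_singleFunctor (Z : DerivedCategory ℬ) (n : ℤ) :
    Nonempty ((t.truncLTGE n (n + 1)).obj Z ≅
      (singleFunctor ℬ n).obj ((homologyFunctor ℬ n).obj Z)) := by
  have : ((t.truncLTGE n (n + 1)).obj Z).IsLE n := t.isLE_truncLT_obj _ _ _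
  obtain ⟨Y, ⟨e⟩⟩ :=
    exists_iso_singleFunctor_obj_of_isGE_of_isLE ((t.truncLTGE n (n + 1)).obj Z) n
  have := isIso_homologyFunctor_map_truncGEπ Z n n le_rfl
  have := isIso_homologyFunctor_map_truncLTι ((t.truncGE n).obj Z) (n + 1) n (by lia)
  exact ⟨e ≪≫ (singleFunctor ℬ n).mapIso
    (((singleFunctorCompHomologyFunctorIso ℬ n).app Y).symm ≪≫
      (homologyFunctor ℬ n).mapIso e.symm ≪≫
      asIso ((homologyFunctor ℬ n).map ((t.truncLTι (n + 1)).app ((t.truncGE n).obj Z))) ≪≫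
      (asIso ((homologyFunctor ℬ n).map ((t.truncGEπ n).app Z))).symm)⟩

/-- The shift of a single complex in degree `n`, expressed through degree `0`. -/
noncomputable def singleFunctorObjShiftIso (Y : ℬ) (n i j : ℤ) (h : n + j = i) :
    ((singleFunctor ℬ n).obj Y)⟦i⟧ ≅ ((singleFunctor ℬ 0).obj Y)⟦j⟧ :=
  (shiftFunctorAdd' (DerivedCategory ℬ) n j i h).app _ ≪≫
    (shiftFunctor _ j).mapIso (((singleFunctors ℬ).shiftIso n 0 n (by lia)).app Y)

theorem eq_zero_of_lt_of_isGE (T : ℬ) (Z : DerivedCategory ℬ) (n i : ℤ) [Z.IsGE n] (h : i < n)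
    (f : (singleFunctor ℬ 0).obj T ⟶ Z⟦i⟧) : f = 0 := by
  have := t.isGE_shift Z n i (n - i)
  exact t.zero f 0 (n - i)

variable [HasExt.{w} ℬ]

theorem eq_zero_of_ext_eq_zero {T Y : ℬ} {n : ℕ} (h : ∀ e : Abelian.Ext T Y n, e = 0)
    (f : (singleFunctor ℬ 0).obj T ⟶ ((singleFunctor ℬ 0).obj Y)⟦(n : ℤ)⟧) : f = 0 :=
  Abelian.Ext.homAddEquiv.symm.injective ((h _).trans (h _).symm)

theorem eq_zero_of_projDim_le_one_of_isGE_of_isLE {T : ℬ}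
    (hpd : ∀ (Y : ℬ) (s : ℕ), 2 ≤ s → ∀ e : Abelian.Ext T Y s, e = 0) (k : ℕ) :
    ∀ (b : ℤ) (Z : DerivedCategory ℬ) [Z.IsGE (b - k)] [Z.IsLE b] (i : ℤ), b + 2 ≤ i →
      ∀ f : (singleFunctor ℬ 0).obj T ⟶ Z⟦i⟧, f = 0 := by
  have concentrated (b : ℤ) (Z : DerivedCategory ℬ) [Z.IsGE b] [Z.IsLE b] (i : ℤ)
      (hi : b + 2 ≤ i) (f : (singleFunctor ℬ 0).obj T ⟶ Z⟦i⟧) : f = 0 := by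
    obtain ⟨Y, ⟨e⟩⟩ := exists_iso_singleFunctor_obj_of_isGE_of_isLE Z b
    obtain ⟨s, rfl⟩ : ∃ s : ℕ, i = b + s := ⟨(i - b).toNat, by lia⟩
    exact ((singleFunctorObjShiftIso Y b (b + s) s rfl).symm ≪≫
      (shiftFunctor _ (b + s : ℤ)).mapIso e.symm).eq_zero_of_forall_eq_zero
        (eq_zero_of_ext_eq_zero (hpd Y s (by lia))) f
  induction k with
  | zero =>
    intro b Z hZ _ i hi
    have : Z.IsGE b := by simpa using hZ
    exact concentrated b Z i hi
  | succ k ih =>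
    intro b Z hZ _ i hi
    have : Z.IsGE (b - 1 - k) := t.isGE_of_ge Z _ (b - (k + 1 : ℕ)) (by lia)
    exact eq_zero_of_hom_shift_obj₁_obj₃ (t.triangleLTGE_distinguished b Z)
      (ih (b - 1) ((t.truncLT b).obj Z) i (by lia))
      (concentrated b ((t.truncGE b).obj Z) i hi)

theorem eq_zero_of_projDim_le_one_of_isLE {T : ℬ}
    (hpd : ∀ (Y : ℬ) (s : ℕ), 2 ≤ s → ∀ e : Abelian.Ext T Y s, e = 0)
    (Z : DerivedCategory ℬ) (a b i : ℤ) [hZ : Z.IsGE a] [Z.IsLE b] (hi : b + 2 ≤ i)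
    (f : (singleFunctor ℬ 0).obj T ⟶ Z⟦i⟧) : f = 0 := by
  have : Z.IsGE (b - (b - a).toNat) := t.isGE_of_ge Z _ a (by lia)
  exact eq_zero_of_projDim_le_one_of_isGE_of_isLE hpd (b - a).toNat b Z i hi f

section Perp

variable {T : ℬ} (hpd : ∀ (Y : ℬ) (s : ℕ), 2 ≤ s → ∀ e : Abelian.Ext T Y s, e = 0)
  (Z : DerivedCategory ℬ) (a : ℤ) [Z.IsGE a]
  (hZ : ∀ (i : ℤ) (f : (singleFunctor ℬ 0).obj T ⟶ Z⟦i⟧), f = 0)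

include hpd hZ a

theorem eq_zero_of_hom_truncGE_shift (n i : ℤ)
    (f : (singleFunctor ℬ 0).obj T ⟶ ((t.truncGE n).obj Z)⟦i⟧) : f = 0 := by
  obtain hi | hi := lt_or_ge i n
  · exact eq_zero_of_lt_of_isGE T _ n i hi f
  · exact eq_zero_of_hom_shift_obj₂_obj₁ (t.triangleLTGE_distinguished n Z) rfl (hZ i)
      (eq_zero_of_projDim_le_one_of_isLE hpd ((t.truncLT n).obj Z) a (n - 1) (i + 1)
        (by lia)) f

theorem eq_zero_of_hom_truncLT_shift (n i : ℤ)
    (f : (singleFunctor ℬ 0).obj T ⟶ ((t.truncLT n).obj Z)⟦i⟧) : f = 0 :=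
  eq_zero_of_hom_shift_obj₃_obj₂ (t.triangleLTGE_distinguished n Z)
    (sub_add_cancel i 1) (eq_zero_of_hom_truncGE_shift hpd Z a hZ n _) (hZ i) f

theorem eq_zero_of_hom_singleFunctor_homology_shift (n i : ℤ)
    (f : (singleFunctor ℬ 0).obj T ⟶
      ((singleFunctor ℬ n).obj ((homologyFunctor ℬ n).obj Z))⟦i⟧) : f = 0 := by
  obtain ⟨e⟩ := nonempty_truncLTGE_obj_iso_singleFunctor Z n
  exact ((shiftFunctor _ i).mapIso e).eq_zero_of_forall_eq_zero
    (eq_zero_of_hom_truncLT_shift hpd ((t.truncGE n).obj Z) n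
      (eq_zero_of_hom_truncGE_shift hpd Z a hZ n) (n + 1) i) f

end Perp

end DerivedCategory

variable {ℬ : Type u} [Category.{v} ℬ] [Abelian ℬ]
  [HasDerivedCategory.{w'} ℬ] [HasExt.{w} ℬ]

/-- Let `T` be an object of projective dimension `≤ 1` in an abelian category `ℬ` and let
`X` be a bounded cochain complex, regarded as an object of the derived category `D(ℬ)`.
If `Hom_{D(ℬ)}(T, X⟦i⟧) = 0` for all integers `i`, then every cohomology object of `X` is
right perpendicular to `T`: `Ext^i(T, H^n(X)) = 0` for all `n ∈ ℤ` and all `i ≥ 0`. -/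
theorem homology_perp_of_perp_of_projDim_le_one
    (T : ℬ)
    (hpd : ∀ (Y : ℬ) (s : ℕ), 2 ≤ s → ∀ e : Abelian.Ext T Y s, e = 0)
    (X : CochainComplex ℬ ℤ)
    (hbdd : ∃ a b : ℤ, ∀ n : ℤ, (n < a ∨ b < n) → IsZero (X.X n))
    (hperp : ∀ (i : ℤ) (f : (DerivedCategory.singleFunctor ℬ 0).obj T ⟶
      (DerivedCategory.Q.obj X)⟦i⟧), f = 0) :
    ∀ (n : ℤ) (i : ℕ) (e : Abelian.Ext T (X.homology n) i), e = 0 := by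
  obtain ⟨a, b, hab⟩ := hbdd
  have : X.IsStrictlyGE a := by
    rw [CochainComplex.isStrictlyGE_iff]
    exact fun n hn ↦ hab n (Or.inl hn)
  intro n i e
  apply Abelian.Ext.homAddEquiv.injective
  rw [map_zero]
  exact ((shiftFunctor _ (n + i : ℤ)).mapIso ((DerivedCategory.singleFunctor ℬ n).mapIso
      ((DerivedCategory.homologyFunctorFactors ℬ n).app X)) ≪≫
    DerivedCategory.singleFunctorObjShiftIso _ n (n + i) i rfl).eq_zero_of_forall_eq_zero
      (DerivedCategory.eq_zero_of_hom_singleFunctor_homology_shift hpd _ a hperp n (n + i)) _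
end
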